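/- arXiv:0906.2129 — 4 statements merged into one kernel-verified Lean document; each statement's English description precedes it below -/
import Mathlib

section
/- Let H be a real Hilbert space, E a real Banach space, i : H → E a compact bounded linear operator, and let S = (S(t))_{t≥0} be a C₀-semigroup of bounded operators on E. Fix T > 0 and x* ∈ E*, and for t ∈ [0,T] let φ(t) ∈ H denote the Riesz representative of the bounded functional h ↦ ⟨S(t)(i h), x*⟩ on H. Then t ↦ φ(t) is continuous from [0,T] into H, and its right-endpoint discretizations converge to it in L²(0,T;H): setting φ^{(n)}(t) := φ(jT/n) for t ∈ ((j−1)T/n, jT/n] (j = 1,…,n), one has lim_{n→∞} ∫_0^T ‖φ^{(n)}(t) − φ(t)‖²_H dt = 0. -/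
open MeasureTheory Filter Set
open scoped Topology RealInnerProductSpace

/-- A strongly continuous family of operators is norm-bounded over a compact set of times. -/
theorem exists_norm_le_of_continuousOn_apply {E F X : Type*} [TopologicalSpace X]
    [NormedAddCommGroup E] [NormedSpace ℝ E] [CompleteSpace E]
    [NormedAddCommGroup F] [NormedSpace ℝ F] {S : X → E →L[ℝ] F} {s : Set X}
    (hs : IsCompact s) (hS : ∀ x, ContinuousOn (fun t => S t x) s) :
    ∃ C, ∀ t ∈ s, ‖S t‖ ≤ C := by
  obtain ⟨C, hC⟩ := banach_steinhaus (g := fun t : s => S t) fun x => by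
    obtain ⟨C, hC⟩ := hs.exists_bound_of_continuousOn (hS x)
    exact ⟨C, fun t => hC t t.2⟩
  exact ⟨C, fun t ht => hC ⟨t, ht⟩⟩

/-- A strongly continuous family of operators on a compact set of times is jointly continuous. -/
theorem continuousOn_uncurry_of_continuousOn_apply {E F X : Type*} [TopologicalSpace X]
    [NormedAddCommGroup E] [NormedSpace ℝ E] [CompleteSpace E]
    [NormedAddCommGroup F] [NormedSpace ℝ F] {S : X → E →L[ℝ] F} {s : Set X}
    (hs : IsCompact s) (hS : ∀ x, ContinuousOn (fun t => S t x) s) (k : Set E) :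
    ContinuousOn (Function.uncurry fun t x => S t x) (s ×ˢ k) := by
  obtain ⟨C, hC⟩ := exists_norm_le_of_continuousOn_apply hs hS
  refine continuousOn_prod_of_continuousOn_lipschitzOnWith' _ C.toNNReal (fun t ht => ?_)
    fun x _ => hS x
  exact ((S t).lipschitz.weaken (by
    rw [← NNReal.coe_le_coe]
    exact (hC t ht).trans (Real.le_coe_toNNReal C))).lipschitzOnWith

/-- Composing a strongly continuous family of functionals with a compact operator gives a
norm-continuous family of Riesz representatives. -/
theorem continuousOn_riesz_of_isCompactOperator {H E X : Type*} [TopologicalSpace X]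
    [NormedAddCommGroup H] [InnerProductSpace ℝ H]
    [NormedAddCommGroup E] [NormedSpace ℝ E] [CompleteSpace E]
    {i : H →L[ℝ] E} (hi : IsCompactOperator i) {s : Set X} (hs : IsCompact s)
    {f : X → E →L[ℝ] ℝ} (hf : ∀ x, ContinuousOn (fun t => f t x) s)
    {φ : X → H} (hφ : ∀ t h, ⟪φ t, h⟫ = f t (i h)) :
    ContinuousOn φ s := by
  intro q hq
  rw [ContinuousWithinAt, Metric.tendsto_nhds]
  intro ε hε
  have hK := hi.isCompact_closure_image_closedBall (𝕜₁ := ℝ) 1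
  obtain ⟨v, hv, hvu⟩ := hK.mem_uniformity_of_prod
    (continuousOn_uncurry_of_continuousOn_apply hs hf _) hq (Metric.dist_mem_uniformity (half_pos hε))
  filter_upwards [hv] with p hp
  refine lt_of_le_of_lt ?_ (half_lt_self hε)
  rw [dist_eq_norm, ← innerSL_apply_norm ℝ]
  refine ContinuousLinearMap.opNorm_le_of_unit_norm (half_pos hε).le fun h hh => ?_
  have := hvu p hp (i h) (subset_closure ⟨h, by simp [hh], rfl⟩)
  rw [innerSL_apply_apply, inner_sub_left, hφ, hφ, ← dist_eq_norm]
  exact le_of_lt this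

/-- The right endpoint `⌈n t / T⌉ T / n` of the mesh interval containing `t` lies in `[0, T]`, at
distance at most `T / n` from `t`. -/
theorem ceil_mesh_mem_Icc_and_dist_le {T t : ℝ} (ht : t ∈ Ioc 0 T) {n : ℕ} (hn : 0 < n) :
    (⌈(n : ℝ) * t / T⌉ : ℝ) * T / n ∈ Icc 0 T ∧
      dist ((⌈(n : ℝ) * t / T⌉ : ℝ) * T / n) t ≤ T / n := by
  obtain ⟨ht0, htT⟩ := ht
  have hT : 0 < T := ht0.trans_le htT
  have hn' : (0 : ℝ) < n := Nat.cast_pos.2 hn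
  have hle : (⌈(n : ℝ) * t / T⌉ : ℝ) ≤ n := by
    exact_mod_cast Int.ceil_le.2 (show (n : ℝ) * t / T ≤ ((n : ℤ) : ℝ) by
      rw [div_le_iff₀ hT]; push_cast; gcongr)
  have hlow : (n : ℝ) * t ≤ ⌈(n : ℝ) * t / T⌉ * T := (div_le_iff₀ hT).1 (Int.le_ceil _)
  have hup : (⌈(n : ℝ) * t / T⌉ : ℝ) * T ≤ n * t + T := by
    have := mul_le_mul_of_nonneg_right (Int.ceil_lt_add_one ((n : ℝ) * t / T)).le hT.le
    rwa [add_mul, div_mul_cancel₀ _ hT.ne', one_mul] at this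
  have hlow' : t ≤ (⌈(n : ℝ) * t / T⌉ : ℝ) * T / n := by
    rw [le_div_iff₀ hn']; linarith
  refine ⟨⟨ht0.le.trans hlow', ?_⟩, ?_⟩
  · rw [div_le_iff₀ hn', mul_comm T]
    gcongr
  · rw [Real.dist_eq, abs_of_nonneg (sub_nonneg.2 hlow'), sub_le_iff_le_add, div_add' _ _ _ hn'.ne']
    gcongr
    linarith

/-- Right-endpoint discretisations of a continuous function on `[0, T]` converge to it in `L²`. -/
theorem tendsto_integral_norm_sub_sq_ceil_mesh {H : Type*} [NormedAddCommGroup H] {T : ℝ}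
    (hT : 0 < T) {φ : ℝ → H} (hφ : ContinuousOn φ (Icc 0 T)) :
    Tendsto (fun n : ℕ =>
      ∫ t in Ioc (0 : ℝ) T, ‖φ ((⌈(n : ℝ) * t / T⌉ : ℝ) * T / n) - φ t‖ ^ 2) atTop (𝓝 0) := by
  rw [Metric.tendsto_nhds]
  intro η hη
  have hε : 0 < √(η / (2 * T)) := by positivity
  obtain ⟨δ, hδ, hφδ⟩ := Metric.uniformContinuousOn_iff.1
    (isCompact_Icc.uniformContinuousOn_of_continuous hφ) _ hε
  have hmesh : ∀ᶠ n : ℕ in atTop, T / n < δ :=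
    (tendsto_const_div_atTop_nhds_zero_nat T).eventually_lt_const hδ
  filter_upwards [hmesh, eventually_gt_atTop 0] with n hnδ hn
  rw [dist_zero_right]
  have hbound : ∀ t ∈ Ioc 0 T,
      ‖‖φ ((⌈(n : ℝ) * t / T⌉ : ℝ) * T / n) - φ t‖ ^ 2‖ ≤ η / (2 * T) := by
    intro t ht
    obtain ⟨hmem, hdist⟩ := ceil_mesh_mem_Icc_and_dist_le ht hn
    have := hφδ _ hmem t (Ioc_subset_Icc_self ht) (hdist.trans_lt hnδ)
    rw [dist_eq_norm] at this
    rw [norm_pow, norm_norm, ← Real.sq_sqrt (show 0 ≤ η / (2 * T) by positivity)]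
    gcongr
  refine (norm_setIntegral_le_of_norm_le_const measure_Ioc_lt_top hbound).trans_lt ?_
  rw [Real.volume_real_Ioc_of_le hT.le, sub_zero]
  have : η / (2 * T) * T = η / 2 := by field_simp
  linarith

/-- Let `i : H → E` be a compact operator from a Hilbert space into a Banach
space, `S` a `C₀`-semigroup on `E`, `T > 0` and `x* ∈ E*`. If `φ(t)` is the Riesz
representative of the functional `h ↦ ⟨S(t)(i h), x*⟩`, then `φ` is continuous on `[0,T]`
and its right-endpoint discretisations `φ⁽ⁿ⁾(t) = φ(⌈nt/T⌉ T/n)` converge to `φ` in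
`L²(0,T;H)`. -/
theorem stmt4 {H E : Type*} [NormedAddCommGroup H] [InnerProductSpace ℝ H] [CompleteSpace H]
    [NormedAddCommGroup E] [NormedSpace ℝ E] [CompleteSpace E]
    (i : H →L[ℝ] E) (hi : IsCompactOperator i)
    (S : ℝ → E →L[ℝ] E)
    -- `S` is a `C₀`-semigroup on `E`:
    (hS0 : S 0 = ContinuousLinearMap.id ℝ E)
    (hSadd : ∀ s t : ℝ, 0 ≤ s → 0 ≤ t → S (s + t) = (S s).comp (S t))
    (hScont : ∀ x : E, ContinuousOn (fun t => S t x) (Ici (0:ℝ)))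
    (T : ℝ) (hT : 0 < T) (xs : E →L[ℝ] ℝ)
    -- `φ(t)` is the Riesz representative of `h ↦ ⟨S(t)(i h), x*⟩`:
    (φ : ℝ → H) (hφ : ∀ t : ℝ, ∀ h : H, ⟪φ t, h⟫ = xs (S t (i h))) :
    ContinuousOn φ (Icc 0 T) ∧
      Tendsto (fun n : ℕ =>
          ∫ t in Ioc (0:ℝ) T, ‖φ ((⌈(n : ℝ) * t / T⌉ : ℝ) * T / n) - φ t‖ ^ 2)
        atTop (𝓝 0) := by
  have hcont : ContinuousOn φ (Icc 0 T) :=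
    continuousOn_riesz_of_isCompactOperator (f := fun t => xs.comp (S t)) hi isCompact_Icc
      (fun x => xs.continuous.comp_continuousOn ((hScont x).mono Icc_subset_Ici_self)) hφ
  exact ⟨hcont, tendsto_integral_norm_sub_sq_ceil_mesh hT hcont⟩
end

section
/- Let n ≥ 1 be an integer, let 0 ≤ s < t ≤ 1 satisfy t − s < 1/(2n), and let 0 < η < 1/2. Define B₁ := { r ∈ (0,s) : ⌈n(t−r)⌉ = ⌈n(s−r)⌉ + 1 }. Then there is a constant C, depending only on η (and not on n, s, t), such that ∫_{B₁} (s−r)^{−2η} dr ≤ C · n · (t−s). -/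
open MeasureTheory Set

lemma sum_rpow_neg_le {a : ℝ} (ha0 : 0 < a) (ha1 : a < 1) (n : ℕ) :
    ∑ m ∈ Finset.range n, ((m : ℝ) + 1) ^ (-a) ≤ (n : ℝ) ^ (1 - a) / (1 - a) := by
  have h1a : 0 < 1 - a := by linarith
  induction n with
  | zero => simp [Real.zero_rpow h1a.ne']
  | succ k ih =>
    rw [Finset.sum_range_succ, Nat.cast_add_one]
    set x : ℝ := (k : ℝ) + 1 with hx
    have hx1 : 1 ≤ x := by simp [hx]
    have hx0 : 0 < x := by linarith
    have hinv : x⁻¹ ≤ 1 := inv_le_one_of_one_le₀ hx1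
    have bernoulli : (1 + -x⁻¹) ^ (1 - a) ≤ 1 + (1 - a) * -x⁻¹ :=
      rpow_one_add_le_one_add_mul_self (by linarith) h1a.le (by linarith)
    have hk : (k : ℝ) = x * (1 + -x⁻¹) := by
      field_simp
      simp [hx]
    have hpow : x ^ (1 - a) * x⁻¹ = x ^ (-a) := by
      rw [← Real.rpow_neg_one x, ← Real.rpow_add hx0]
      congr 1
      ring
    have step : (k : ℝ) ^ (1 - a) ≤ x ^ (1 - a) - (1 - a) * x ^ (-a) := by
      rw [hk, Real.mul_rpow hx0.le (by linarith), ← hpow]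
      have := mul_le_mul_of_nonneg_left bernoulli (Real.rpow_nonneg hx0.le (1 - a))
      linarith
    have := div_le_div_of_nonneg_right step h1a.le
    rw [sub_div, mul_div_cancel_left₀ _ h1a.ne'] at this
    linarith

lemma exists_mem_Ico_of_ceil_eq {n : ℕ} {r s t : ℝ} (hn : 1 ≤ n) (hr : r ∈ Ioo 0 s)
    (hs : s ≤ 1)
    (h : ⌈(n : ℝ) * (t - r)⌉ = ⌈(n : ℝ) * (s - r)⌉ + 1) :
    ∃ m ∈ Finset.range n,
      r ∈ Ico (s - ((m : ℝ) + 1) / n) (s - ((m : ℝ) + 1) / n + (t - s)) := by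
  have hn0 : (0 : ℝ) < n := by exact_mod_cast hn
  obtain ⟨hr0, hrs⟩ := hr
  have hpos : 0 < ⌈(n : ℝ) * (s - r)⌉ := Int.ceil_pos.2 (mul_pos hn0 (by linarith))
  have hle : ⌈(n : ℝ) * (s - r)⌉ ≤ n := by
    rw [Int.ceil_le, Int.cast_natCast]
    nlinarith
  obtain ⟨m, hm⟩ : ∃ m : ℕ, ⌈(n : ℝ) * (s - r)⌉ = (m : ℤ) + 1 :=
    ⟨(⌈(n : ℝ) * (s - r)⌉ - 1).toNat, by omega⟩
  have upper : (n : ℝ) * (s - r) ≤ (m : ℝ) + 1 := by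
    have := Int.le_ceil ((n : ℝ) * (s - r))
    rw [hm] at this
    exact_mod_cast this
  have lower : (m : ℝ) + 1 < n * (t - r) := by
    have : (m : ℤ) + 1 < ⌈(n : ℝ) * (t - r)⌉ := by omega
    rw [Int.lt_ceil] at this
    exact_mod_cast this
  refine ⟨m, Finset.mem_range.2 (by omega), ?_, ?_⟩
  · have : s - r ≤ ((m : ℝ) + 1) / n := by
      rw [le_div_iff₀ hn0]
      linarith
    linarith
  · have : ((m : ℝ) + 1) / n < t - r := by
      rw [div_lt_iff₀ hn0]
      linarith
    linarith

/-- For `0 < η < 1/2` there is a constant `C = C(η)` such that for all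
integers `n ≥ 1` and all `0 ≤ s < t ≤ 1` with `t − s < 1/(2n)`, the set
`B₁ = {r ∈ (0,s) : ⌈n(t−r)⌉ = ⌈n(s−r)⌉ + 1}` satisfies
`∫_{B₁} (s−r)^{−2η} dr ≤ C n (t−s)`. -/
theorem stmt6 (η : ℝ) (hη0 : 0 < η) (hη : η < 1 / 2) :
    ∃ C : ℝ, ∀ (n : ℕ) (s t : ℝ), 1 ≤ n → 0 ≤ s → s < t → t ≤ 1 →
      t - s < 1 / (2 * n) →
      (∫ r in {r ∈ Ioo (0:ℝ) s | ⌈(n : ℝ) * (t - r)⌉ = ⌈(n : ℝ) * (s - r)⌉ + 1},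
          (s - r) ^ (-(2 * η))) ≤ C * n * (t - s) := by
  obtain ⟨a, ha⟩ : ∃ a, a = 2 * η := ⟨_, rfl⟩
  rw [← ha]
  have ha0 : 0 < a := by linarith
  have ha1 : a < 1 := by linarith
  refine ⟨2 ^ a / (1 - a), fun n s t hn _ hst ht hδ => ?_⟩
  have hn0 : (0 : ℝ) < n := by exact_mod_cast hn
  set B := {r ∈ Ioo (0:ℝ) s | ⌈(n : ℝ) * (t - r)⌉ = ⌈(n : ℝ) * (s - r)⌉ + 1}
  have hBmeas : MeasurableSet B :=
    measurableSet_Ioo.inter (measurableSet_eq_fun (by fun_prop) (by fun_prop))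
  let I : ℕ → Set ℝ := fun m =>
    Ico (s - ((m : ℝ) + 1) / n) (s - ((m : ℝ) + 1) / n + (t - s))
  let c : ℕ → ℝ := fun m => (((m : ℝ) + 1) / (2 * n)) ^ (-a)
  have hc : ∀ m, 0 ≤ c m := fun m => by positivity
  let g : ℝ → ℝ := fun r => ∑ m ∈ Finset.range n, (I m).indicator (fun _ => c m) r
  have hterm : ∀ m, Integrable ((I m).indicator fun _ => c m) := fun m =>
    (integrableOn_const (by simp [I])).integrable_indicator measurableSet_Ico
  have hg : Integrable g := integrable_finsetSum _ fun m _ => hterm m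
  have hterm0 : ∀ m r, 0 ≤ (I m).indicator (fun _ => c m) r := fun m r =>
    indicator_nonneg (fun _ _ => hc m) r
  have hg0 : ∀ r, 0 ≤ g r := fun r => Finset.sum_nonneg fun m _ => hterm0 m r
  have hfg : ∀ r ∈ B, (s - r) ^ (-a) ≤ g r := by
    rintro r ⟨hr, hceil⟩
    obtain ⟨m, hm, hrm⟩ := exists_mem_Ico_of_ceil_eq hn hr (by linarith) hceil
    have hlow : ((m : ℝ) + 1) / (2 * n) ≤ s - r := by
      have h1 : 1 / (2 * (n : ℝ)) ≤ ((m : ℝ) + 1) / (2 * n) := by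
        gcongr
        simp
      have h2 : ((m : ℝ) + 1) / n = 2 * (((m : ℝ) + 1) / (2 * n)) := by
        field_simp
      linarith [hrm.2]
    calc (s - r) ^ (-a) ≤ c m :=
          Real.rpow_le_rpow_of_nonpos (by positivity) hlow (by linarith)
      _ = (I m).indicator (fun _ => c m) r := (indicator_of_mem (s := I m) hrm fun _ => c m).symm
      _ ≤ g r := Finset.single_le_sum (f := fun m => (I m).indicator (fun _ => c m) r)
          (fun m _ => hterm0 m r) hm
  have hcm : ∀ m : ℕ, c m = (2 * n : ℝ) ^ a * ((m : ℝ) + 1) ^ (-a) := fun m => by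
    simp only [c]
    rw [Real.div_rpow (by positivity) (by positivity), Real.rpow_neg (x := 2 * (n : ℝ))
      (by positivity), div_inv_eq_mul, mul_comm]
  calc ∫ r in B, (s - r) ^ (-a) ≤ ∫ r in B, g r :=
        integral_mono_of_nonneg
          (ae_restrict_of_forall_mem hBmeas fun r hr =>
            Real.rpow_nonneg (sub_nonneg.2 hr.1.2.le) _)
          hg.integrableOn (ae_restrict_of_forall_mem hBmeas hfg)
    _ ≤ ∫ r, g r := setIntegral_le_integral hg (ae_of_all _ hg0)
    _ = ∑ m ∈ Finset.range n, (t - s) * c m := by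
        rw [integral_finsetSum _ fun m _ => hterm m]
        refine Finset.sum_congr rfl fun m _ => ?_
        rw [integral_indicator measurableSet_Ico, setIntegral_const]
        simp [Measure.real, hst.le]
    _ = (t - s) * (2 * n : ℝ) ^ a * ∑ m ∈ Finset.range n, ((m : ℝ) + 1) ^ (-a) := by
        rw [Finset.mul_sum]
        exact Finset.sum_congr rfl fun m _ => by rw [hcm, mul_assoc]
    _ ≤ (t - s) * (2 * n : ℝ) ^ a * ((n : ℝ) ^ (1 - a) / (1 - a)) :=
        mul_le_mul_of_nonneg_left (sum_rpow_neg_le ha0 ha1 n)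
          (mul_nonneg (by linarith) (by positivity))
    _ = 2 ^ a / (1 - a) * n * (t - s) := by
        have hpow : (n : ℝ) ^ a * (n : ℝ) ^ (1 - a) = n := by
          rw [← Real.rpow_add hn0, add_sub_cancel, Real.rpow_one]
        rw [Real.mul_rpow (by norm_num) hn0.le]
        linear_combination (t - s) * 2 ^ a / (1 - a) * hpow
end

section
/- Fix real numbers p, u, r with 1 ≤ p < 2, u > 2/p and 0 < r < 1 − p/2. For integers k ≥ 1 and 0 ≤ j ≤ 2^{k−1}−1 set I_{k,j} := ((2j+1)2^{−k}, (2j+1)2^{−k} + 2^{−uk}]. Then: (i) for each fixed k the intervals I_{k,0},…,I_{k,2^{k−1}−1} are pairwise disjoint and each is contained in (0,1); (ii) for every t ∈ ℝ the series f(t) := Σ_{k≥1} Σ_{j=0}^{2^{k−1}−1} 2^{−rk/p} 1_{I_{k,j}}(t) e_{2^{k−1}+j} converges in ℓ^p and ‖f(t)‖^p_{ℓ^p} ≤ Σ_{k≥1} 2^{−rk} < ∞; (iii) f(t) = 0 for all t ∉ (0,1). -/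
open Set
open scoped ENNReal

/-- The interval `I_{k,j} = ((2j+1)2^{-k}, (2j+1)2^{-k} + 2^{-uk}]`. -/
noncomputable def Ikj (u : ℝ) (k j : ℕ) : Set ℝ :=
  Ioc ((2 * j + 1) * (2 : ℝ) ^ (-(k : ℝ)))
    ((2 * j + 1) * (2 : ℝ) ^ (-(k : ℝ)) + (2 : ℝ) ^ (-(u * k)))

/-- The term of index `(k,j)` (with `k ≥ 1` encoded as `kj.1 + 1` and `j = kj.2 < 2^{k-1}`)
of the series defining `f(t)`, namely `2^{-rk/p} 1_{I_{k,j}}(t) e_{2^{k-1}+j} ∈ ℓ^p`. -/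
noncomputable def splitTerm (p u r : ℝ) [Fact (1 ≤ ENNReal.ofReal p)] (t : ℝ)
    (kj : Σ k : ℕ, Fin (2 ^ k)) : lp (fun _ : ℕ => ℝ) (ENNReal.ofReal p) :=
  Set.indicator (Ikj u (kj.1 + 1) kj.2)
      (fun _ => (2 : ℝ) ^ (-(r * ((kj.1 : ℝ) + 1)) / p)) t •
    lp.single (ENNReal.ofReal p) (2 ^ kj.1 + (kj.2 : ℕ)) (1 : ℝ)

/-- The function `f : ℝ → ℓ^p`,
`f(t) = ∑_{k≥1} ∑_{j=0}^{2^{k-1}-1} 2^{-rk/p} 1_{I_{k,j}}(t) e_{2^{k-1}+j}`. -/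
noncomputable def splitF (p u r : ℝ) [Fact (1 ≤ ENNReal.ofReal p)] (t : ℝ) :
    lp (fun _ : ℕ => ℝ) (ENNReal.ofReal p) :=
  ∑' kj : Σ k : ℕ, Fin (2 ^ k), splitTerm p u r t kj

/-- A family of indicators of sets `A k i`, pairwise disjoint in `i`, weighted by a summable
nonnegative sequence `b k`, sums to at most `∑ b k` at each point. -/
theorem summable_sigma_indicator_and_tsum_le {α : Type*} {ι : ℕ → Type*} [∀ k, Fintype (ι k)]
    {A : ∀ k, ι k → Set α} (hA : ∀ k, Pairwise fun i j => Disjoint (A k i) (A k j))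
    {b : ℕ → ℝ} (hb : ∀ k, 0 ≤ b k) (hbs : Summable b) (t : α) :
    Summable (fun x : Σ k, ι k => (A x.1 x.2).indicator (fun _ => b x.1) t) ∧
      ∑' x : Σ k, ι k, (A x.1 x.2).indicator (fun _ => b x.1) t ≤ ∑' k, b k := by
  have hle (k : ℕ) : ∑ i, (A k i).indicator (fun _ => b k) t ≤ b k := by
    by_cases h : ∃ i, t ∈ A k i
    · obtain ⟨i, hi⟩ := h
      rw [Finset.sum_eq_single i]
      · simp [hi]
      · intro j _ hji
        exact Set.indicator_of_notMem (fun hj => Set.disjoint_left.1 (hA k hji) hj hi) _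
      · simp
    · push Not at h
      simpa [h] using hb k
  have hnn : ∀ x : Σ k, ι k, 0 ≤ (A x.1 x.2).indicator (fun _ => b x.1) t :=
    fun x => Set.indicator_nonneg (fun _ _ => hb _) _
  have hout : Summable fun k => ∑' i, (A k i).indicator (fun _ => b k) t := by
    refine Summable.of_nonneg_of_le (fun k => tsum_nonneg fun i => hnn ⟨k, i⟩) (fun k => ?_) hbs
    rw [tsum_fintype]
    exact hle k
  have hs : Summable (fun x : Σ k, ι k => (A x.1 x.2).indicator (fun _ => b x.1) t) :=
    (summable_sigma_of_nonneg hnn).2 ⟨fun k => (hasSum_fintype _).summable, hout⟩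
  refine ⟨hs, ?_⟩
  rw [hs.tsum_sigma]
  refine hout.tsum_le_tsum (fun k => ?_) hbs
  rw [tsum_fintype]
  exact hle k

/-- The norm of a finite combination of distinct unit vectors of `ℓ^p`. -/
theorem lp_norm_rpow_sum_smul_single {ι : Type*} {p : ℝ≥0∞} (hp : 0 < p.toReal) {φ : ι → ℕ}
    (hφ : Function.Injective φ) (c : ι → ℝ) (s : Finset ι) :
    ‖∑ i ∈ s, c i • (lp.single p (φ i) (1 : ℝ) : lp (fun _ : ℕ => ℝ) p)‖ ^ p.toReal =
      ∑ i ∈ s, ‖c i‖ ^ p.toReal := by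
  have h := lp.norm_sum_single hp (Function.extend φ c 0) (s.map ⟨φ, hφ⟩)
  simpa [Finset.sum_map, hφ.extend_apply, ← lp.single_smul] using h

theorem two_pow_add_fin_injective :
    Function.Injective fun x : Σ k : ℕ, Fin (2 ^ k) => 2 ^ x.1 + (x.2 : ℕ) := by
  have hlog (x : Σ k : ℕ, Fin (2 ^ k)) : Nat.log 2 (2 ^ x.1 + (x.2 : ℕ)) = x.1 := by
    refine Nat.log_eq_of_pow_le_of_lt_pow (Nat.le_add_right _ _) ?_
    rw [pow_succ]
    have := x.2.2
    omega
  intro x y h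
  have h' : x.1 = y.1 := by rw [← hlog x, ← hlog y]; exact congrArg _ h
  obtain ⟨k, i⟩ := x
  obtain ⟨l, j⟩ := y
  obtain rfl : k = l := h'
  have : (i : ℕ) = j := by simpa using h
  rw [Fin.ext this]

theorem Ikj_subset_Ioo {u : ℝ} (hu : 1 < u) {k : ℕ} (hk : 1 ≤ k) (j : ℕ) :
    Ikj u k j ⊆ Ioo ((2 * j + 1) * (2 : ℝ) ^ (-(k : ℝ))) ((2 * j + 2) * (2 : ℝ) ^ (-(k : ℝ))) := by
  intro t ht
  have hk' : (1 : ℝ) ≤ k := by exact_mod_cast hk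
  have : (2 : ℝ) ^ (-(u * k)) < (2 : ℝ) ^ (-(k : ℝ)) :=
    Real.rpow_lt_rpow_of_exponent_lt (by norm_num) (by nlinarith)
  exact ⟨ht.1, by linarith [ht.2]⟩

theorem disjoint_Ikj {u : ℝ} (hu : 1 < u) {k : ℕ} (hk : 1 ≤ k) {i j : ℕ} (hij : i ≠ j) :
    Disjoint (Ikj u k i) (Ikj u k j) := by
  wlog h : i < j generalizing i j
  · exact (this hij.symm (by omega)).symm
  rw [Set.disjoint_left]
  intro t hi hj
  have h1 := (Ikj_subset_Ioo hu hk i hi).2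
  have h2 := (Ikj_subset_Ioo hu hk j hj).1
  have hij' : (i : ℝ) + 1 ≤ j := by exact_mod_cast h
  have : (0 : ℝ) < (2 : ℝ) ^ (-(k : ℝ)) := by positivity
  nlinarith

theorem Ikj_subset_Ioo_zero_one {u : ℝ} (hu : 1 < u) {k : ℕ} (hk : 1 ≤ k) {j : ℕ}
    (hj : j < 2 ^ (k - 1)) : Ikj u k j ⊆ Ioo (0 : ℝ) 1 := by
  refine (Ikj_subset_Ioo hu hk j).trans (Set.Ioo_subset_Ioo (by positivity) ?_)
  have h : 2 * j + 2 ≤ 2 ^ k := by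
    obtain ⟨m, rfl⟩ := Nat.exists_eq_add_of_le' hk
    rw [Nat.add_sub_cancel] at hj
    rw [pow_succ]
    omega
  have h' : (2 * j + 2 : ℝ) ≤ 2 ^ k := by exact_mod_cast h
  rw [Real.rpow_neg (by norm_num), Real.rpow_natCast, ← div_eq_mul_inv]
  exact (div_le_one (by positivity)).2 h'

theorem summable_two_rpow_neg_mul_succ {r : ℝ} (hr : 0 < r) :
    Summable fun k : ℕ => (2 : ℝ) ^ (-(r * ((k : ℝ) + 1))) := by
  have h := (summable_geometric_of_lt_one (r := (2 : ℝ) ^ (-r)) (by positivity)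
    (Real.rpow_lt_one_of_one_lt_of_neg (by norm_num) (by linarith))).mul_left ((2 : ℝ) ^ (-r))
  refine h.congr fun k => ?_
  rw [← Real.rpow_natCast, ← Real.rpow_mul (by norm_num), ← Real.rpow_add (by norm_num)]
  ring_nf

/-- Basic properties of the intervals `I_{k,j}` and of `f`:
(i) for fixed `k ≥ 1` the intervals `I_{k,j}`, `0 ≤ j ≤ 2^{k-1}-1`, are pairwise disjoint and
contained in `(0,1)`; (ii) the series defining `f(t)` converges in `ℓ^p` with
`‖f(t)‖^p ≤ ∑_{k≥1} 2^{-rk} < ∞`; (iii) `f(t) = 0` for `t ∉ (0,1)`. -/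
theorem stmt7 (p u r : ℝ) [Fact (1 ≤ ENNReal.ofReal p)]
    (hp1 : 1 ≤ p) (hp2 : p < 2) (hu : 2 / p < u) (hr0 : 0 < r) (hr : r < 1 - p / 2) :
    (∀ k : ℕ, 1 ≤ k →
      (∀ i j : ℕ, i < 2 ^ (k - 1) → j < 2 ^ (k - 1) → i ≠ j →
        Disjoint (Ikj u k i) (Ikj u k j)) ∧
      ∀ j : ℕ, j < 2 ^ (k - 1) → Ikj u k j ⊆ Ioo (0 : ℝ) 1) ∧
    (∀ t : ℝ,
      Summable (splitTerm p u r t) ∧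
      Summable (fun k : ℕ => (2 : ℝ) ^ (-(r * ((k : ℝ) + 1)))) ∧
      ‖splitF p u r t‖ ^ p ≤ ∑' k : ℕ, (2 : ℝ) ^ (-(r * ((k : ℝ) + 1)))) ∧
    ∀ t : ℝ, t ∉ Ioo (0 : ℝ) 1 → splitF p u r t = 0 := by
  have hp0 : 0 < p := by linarith
  have hu1 : 1 < u := lt_trans ((one_lt_div hp0).2 hp2) hu
  have hdisj : ∀ k : ℕ, Pairwise fun i j : Fin (2 ^ k) =>
      Disjoint (Ikj u (k + 1) i) (Ikj u (k + 1) j) :=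
    fun k i j hij => disjoint_Ikj hu1 (Nat.le_add_left 1 k) (Fin.val_ne_of_ne hij)
  have hpr : (ENNReal.ofReal p).toReal = p := ENNReal.toReal_ofReal hp0.le
  have hsum (t : ℝ) : Summable (splitTerm p u r t) := by
    have hs : Summable fun k : ℕ => (2 : ℝ) ^ (-(r * ((k : ℝ) + 1)) / p) := by
      refine (summable_two_rpow_neg_mul_succ (div_pos hr0 hp0)).congr fun k => ?_
      ring_nf
    refine Summable.of_norm ((summable_sigma_indicator_and_tsum_le hdisj
      (fun k => by positivity) hs t).1.congr fun x => ?_)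
    rw [splitTerm, norm_smul, lp.norm_single (by simpa using hp0), norm_one, mul_one,
      Real.norm_of_nonneg (Set.indicator_nonneg (fun _ _ => by positivity) _)]
  refine ⟨fun k hk => ⟨fun i j _ _ hij => disjoint_Ikj hu1 hk hij,
    fun j hj => Ikj_subset_Ioo_zero_one hu1 hk hj⟩, fun t => ⟨hsum t,
    summable_two_rpow_neg_mul_succ hr0, ?_⟩, fun t ht => ?_⟩
  · obtain ⟨hs, hle⟩ := summable_sigma_indicator_and_tsum_le hdisj
      (fun k => by positivity) (summable_two_rpow_neg_mul_succ hr0) t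
    refine le_of_tendsto (((hsum t).hasSum.norm).rpow_const (Or.inr hp0.le))
      (Filter.Eventually.of_forall fun s => ?_)
    refine le_trans (le_of_eq ?_) ((hs.sum_le_tsum s fun x _ =>
      Set.indicator_nonneg (fun _ _ => by positivity) _).trans hle)
    have h := lp_norm_rpow_sum_smul_single (p := ENNReal.ofReal p) (by rwa [hpr])
      two_pow_add_fin_injective (fun x : Σ k : ℕ, Fin (2 ^ k) =>
        Set.indicator (Ikj u (x.1 + 1) x.2)
          (fun _ => (2 : ℝ) ^ (-(r * ((x.1 : ℝ) + 1)) / p)) t) s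
    rw [hpr] at h
    refine h.trans (Finset.sum_congr rfl fun x _ => ?_)
    by_cases hx : t ∈ Ikj u (x.1 + 1) x.2
    · rw [Set.indicator_of_mem hx, Set.indicator_of_mem hx, Real.norm_of_nonneg (by positivity),
        ← Real.rpow_mul (by norm_num), div_mul_cancel₀ _ hp0.ne']
    · rw [Set.indicator_of_notMem hx, Set.indicator_of_notMem hx, norm_zero,
        Real.zero_rpow hp0.ne']
  · have h0 (x : Σ k : ℕ, Fin (2 ^ k)) : splitTerm p u r t x = 0 := by
      rw [splitTerm, Set.indicator_of_notMem, zero_smul]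
      exact fun hx => ht (Ikj_subset_Ioo_zero_one hu1 (Nat.le_add_left 1 _) x.2.2 hx)
    simp [splitF, h0]
end

section
/- Fix real numbers p, u, r with 1 ≤ p < 2, u > 2/p and 0 < r < 1 − p/2, and let f : ℝ → ℓ^p be defined by f(t) := Σ_{k≥1} Σ_{j=0}^{2^{k−1}−1} 2^{−rk/p} 1_{I_{k,j}}(t) e_{2^{k−1}+j}, where I_{k,j} := ((2j+1)2^{−k}, (2j+1)2^{−k} + 2^{−uk}]. For integers n ≥ 1, 1 ≤ k ≤ n, 0 ≤ j ≤ 2^{k−1}−1, set i_{k,j} := 2^{n−k}(2j+1), so that i_{k,j}/2^n = (2j+1)/2^k. Then for every s ∈ (0, 2^{−un}] and every t ∈ ((i_{k,j}−1)2^{−n}, i_{k,j}·2^{−n}], the (2^{k−1}+j)-th coordinate of f(2^{−n}⌈2^n t⌉ + s) equals 2^{−rk/p}. -/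
open Set
open scoped ENNReal

lemma Ikj_index_unique {u : ℝ} (hu : 1 ≤ u) {k i j : ℕ} {t : ℝ} (hi : t ∈ Ikj u k i)
    (hj : t ∈ Ikj u k j) : i = j := by
  have hle : (2 : ℝ) ^ (-(u * k)) ≤ (2 : ℝ) ^ (-(k : ℝ)) := by
    apply Real.rpow_le_rpow_of_exponent_le one_le_two
    nlinarith [(Nat.cast_nonneg k : (0 : ℝ) ≤ k)]
  have hpos : (0 : ℝ) < (2 : ℝ) ^ (-(k : ℝ)) := by positivity
  have key : ∀ {a b : ℕ}, t ∈ Ikj u k a → t ∈ Ikj u k b → a ≤ b := by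
    intro a b ha hb
    have h : (2 * (a : ℝ) + 1) * (2 : ℝ) ^ (-(k : ℝ)) <
        (2 * (b : ℝ) + 2) * (2 : ℝ) ^ (-(k : ℝ)) := by
      linarith [ha.1, hb.2]
    have h' := lt_of_mul_lt_mul_right h hpos.le
    have : 2 * a + 1 < 2 * b + 2 := by exact_mod_cast h'
    omega
  exact le_antisymm (key hi hj) (key hj hi)

lemma sum_indicator_Ikj_le {u c : ℝ} (hu : 1 ≤ u) (hc : 0 ≤ c) (k m : ℕ) (t : ℝ) :
    ∑ j : Fin m, (Ikj u k j).indicator (fun _ => c) t ≤ c := by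
  by_cases h : ∃ j : Fin m, t ∈ Ikj u k j
  · obtain ⟨j, hj⟩ := h
    rw [Finset.sum_eq_single j]
    · simp [hj]
    · intro i _ hij
      exact indicator_of_notMem (fun hi => hij (Fin.ext (Ikj_index_unique hu hi hj))) _
    · simp
  · push Not at h
    simpa [h] using hc

lemma norm_splitTerm (p u r : ℝ) [Fact (1 ≤ ENNReal.ofReal p)] (t : ℝ)
    (kj : Σ k : ℕ, Fin (2 ^ k)) :
    ‖splitTerm p u r t kj‖ = (Ikj u (kj.1 + 1) kj.2).indicator
      (fun _ => (2 : ℝ) ^ (-(r * ((kj.1 : ℝ) + 1)) / p)) t := by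
  have hp : 0 < ENNReal.ofReal p := zero_lt_one.trans_le Fact.out
  rw [splitTerm, norm_smul, lp.norm_single hp, norm_one, mul_one, Real.norm_eq_abs, abs_of_nonneg]
  exact indicator_nonneg (fun _ _ => by positivity) _

lemma summable_two_rpow_neg {p r : ℝ} (hp : 0 < p) (hr : 0 < r) :
    Summable fun k : ℕ => (2 : ℝ) ^ (-(r * ((k : ℝ) + 1)) / p) := by
  have h1 : (2 : ℝ) ^ (-(r / p)) < 1 :=
    Real.rpow_lt_one_of_one_lt_of_neg one_lt_two (neg_neg_of_pos (div_pos hr hp))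
  refine ((summable_geometric_of_lt_one (by positivity) h1).mul_left
    ((2 : ℝ) ^ (-(r / p)))).congr fun k => ?_
  rw [← Real.rpow_natCast, ← Real.rpow_mul zero_le_two, ← Real.rpow_add zero_lt_two]
  congr 1
  ring

lemma summable_indicator_Ikj {u : ℝ} (hu : 1 ≤ u) {c : ℕ → ℝ} (hc : ∀ k, 0 ≤ c k)
    (hsum : Summable c) (t : ℝ) :
    Summable fun kj : Σ k : ℕ, Fin (2 ^ k) =>
      (Ikj u (kj.1 + 1) kj.2).indicator (fun _ => c kj.1) t := by
  rw [summable_sigma_of_nonneg fun kj => indicator_nonneg (fun _ _ => hc kj.1) t]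
  refine ⟨fun k => Summable.of_finite, ?_⟩
  simp_rw [tsum_fintype]
  exact hsum.of_nonneg_of_le
    (fun k => Finset.sum_nonneg fun j _ => indicator_nonneg (fun _ _ => hc k) t)
    fun k => sum_indicator_Ikj_le hu (hc k) (k + 1) (2 ^ k) t

lemma summable_splitTerm {p u r : ℝ} [Fact (1 ≤ ENNReal.ofReal p)] (hp : 0 < p) (hu : 1 ≤ u)
    (hr : 0 < r) (t : ℝ) : Summable (splitTerm p u r t) :=
  .of_norm ((summable_indicator_Ikj hu (fun _ => by positivity)
    (summable_two_rpow_neg hp hr) t).congr fun kj => (norm_splitTerm p u r t kj).symm)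

lemma sigma_eq_of_two_pow_add_eq {a b : Σ k : ℕ, Fin (2 ^ k)}
    (h : 2 ^ a.1 + (a.2 : ℕ) = 2 ^ b.1 + (b.2 : ℕ)) : a = b := by
  have hlog : ∀ c : Σ k : ℕ, Fin (2 ^ k), Nat.log 2 (2 ^ c.1 + (c.2 : ℕ)) = c.1 := by
    intro c
    have := c.2.isLt
    exact Nat.log_eq_of_pow_le_of_lt_pow (by omega) (by rw [pow_succ']; omega)
  have h1 : a.1 = b.1 := by rw [← hlog a, h, hlog b]
  obtain ⟨k, i⟩ := a
  obtain ⟨l, j⟩ := b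
  obtain rfl : k = l := h1
  congr 1
  exact Fin.ext (Nat.add_left_cancel h)

lemma splitF_apply {p u r : ℝ} [Fact (1 ≤ ENNReal.ofReal p)] (hp : 0 < p) (hu : 1 ≤ u)
    (hr : 0 < r) (t : ℝ) (kj : Σ k : ℕ, Fin (2 ^ k)) :
    splitF p u r t (2 ^ kj.1 + (kj.2 : ℕ)) = (Ikj u (kj.1 + 1) kj.2).indicator
      (fun _ => (2 : ℝ) ^ (-(r * ((kj.1 : ℝ) + 1)) / p)) t := by
  have h := (lp.evalCLM ℝ (fun _ : ℕ => ℝ) (ENNReal.ofReal p) (2 ^ kj.1 + (kj.2 : ℕ))).map_tsum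
    (summable_splitTerm hp hu hr t)
  change splitF p u r t (2 ^ kj.1 + (kj.2 : ℕ)) =
    ∑' b, splitTerm p u r t b (2 ^ kj.1 + (kj.2 : ℕ)) at h
  rw [h, tsum_eq_single kj]
  · simp [splitTerm]
  · intro b hb
    have hne : 2 ^ kj.1 + (kj.2 : ℕ) ≠ 2 ^ b.1 + (b.2 : ℕ) :=
      fun e => hb (sigma_eq_of_two_pow_add_eq e.symm)
    simp [splitTerm, hne]

/-- For `1 ≤ k ≤ n`, `0 ≤ j ≤ 2^{k-1}-1`, `i_{k,j} = 2^{n-k}(2j+1)`,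
`s ∈ (0, 2^{-un}]` and `t ∈ ((i_{k,j}-1)2^{-n}, i_{k,j} 2^{-n}]`, the `(2^{k-1}+j)`-th
coordinate of `f(2^{-n}⌈2^n t⌉ + s)` equals `2^{-rk/p}`. -/
theorem stmt8 (p u r : ℝ) [Fact (1 ≤ ENNReal.ofReal p)]
    (hp1 : 1 ≤ p) (hp2 : p < 2) (hu : 2 / p < u) (hr0 : 0 < r) (hr : r < 1 - p / 2)
    (n k j : ℕ) (hn : 1 ≤ n) (hk1 : 1 ≤ k) (hkn : k ≤ n) (hj : j ≤ 2 ^ (k - 1) - 1)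
    (s t : ℝ) (hs : s ∈ Ioc (0 : ℝ) ((2 : ℝ) ^ (-(u * n))))
    (ht : t ∈ Ioc ((((2 ^ (n - k) * (2 * j + 1) : ℕ) : ℝ) - 1) * (2 : ℝ) ^ (-(n : ℝ)))
      (((2 ^ (n - k) * (2 * j + 1) : ℕ) : ℝ) * (2 : ℝ) ^ (-(n : ℝ)))) :
    (splitF p u r ((2 : ℝ) ^ (-(n : ℝ)) * (⌈(2 : ℝ) ^ n * t⌉ : ℝ) + s))
        (2 ^ (k - 1) + j) = (2 : ℝ) ^ (-(r * k) / p) := by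
  have hp : 0 < p := by linarith
  have hu1 : 1 ≤ u := by
    have : 1 ≤ 2 / p := (one_le_div hp).2 hp2.le
    linarith
  obtain ⟨k, rfl⟩ : ∃ l, k = l + 1 := ⟨k - 1, by omega⟩
  rw [Nat.add_sub_cancel] at hj ⊢
  have hjlt : j < 2 ^ k := by
    have := Nat.two_pow_pos k
    omega
  have hn2 : (2 : ℝ) ^ (-(n : ℝ)) * (2 : ℝ) ^ n = 1 := by
    rw [Real.rpow_neg zero_le_two, Real.rpow_natCast, inv_mul_cancel₀ (by positivity)]
  have hceil : ⌈(2 : ℝ) ^ n * t⌉ = ((2 ^ (n - (k + 1)) * (2 * j + 1) : ℕ) : ℤ) := by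
    have hpos : (0 : ℝ) < 2 ^ n := by positivity
    have h1 := mul_lt_mul_of_pos_left ht.1 hpos
    have h2 := mul_le_mul_of_nonneg_left ht.2 hpos.le
    rw [mul_left_comm, mul_comm ((2 : ℝ) ^ n) (_ ^ _), hn2, mul_one] at h1 h2
    rw [Int.ceil_eq_iff, Int.cast_natCast]
    exact ⟨h1, h2⟩
  have hpt : (2 : ℝ) ^ (-(n : ℝ)) * (⌈(2 : ℝ) ^ n * t⌉ : ℝ) =
      (2 * j + 1) * (2 : ℝ) ^ (-((k + 1 : ℕ) : ℝ)) := by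
    have hsplit : (2 : ℝ) ^ (-(n : ℝ)) * 2 ^ (n - (k + 1)) = (2 : ℝ) ^ (-((k + 1 : ℕ) : ℝ)) := by
      rw [← Real.rpow_natCast, ← Real.rpow_add zero_lt_two, Nat.cast_sub hkn]
      congr 1
      ring
    rw [hceil, Int.cast_natCast, ← hsplit]
    push_cast
    ring
  have hsle : (2 : ℝ) ^ (-(u * n)) ≤ (2 : ℝ) ^ (-(u * (k + 1 : ℕ))) := by
    apply Real.rpow_le_rpow_of_exponent_le one_le_two
    have : ((k + 1 : ℕ) : ℝ) ≤ n := Nat.cast_le.2 hkn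
    nlinarith
  have hmem : (2 : ℝ) ^ (-(n : ℝ)) * (⌈(2 : ℝ) ^ n * t⌉ : ℝ) + s ∈ Ikj u (k + 1) j := by
    rw [hpt]
    exact ⟨by linarith [hs.1], by linarith [hs.2]⟩
  have h := splitF_apply hp hu1 hr0 ((2 : ℝ) ^ (-(n : ℝ)) * (⌈(2 : ℝ) ^ n * t⌉ : ℝ) + s)
    ⟨k, ⟨j, hjlt⟩⟩
  rw [indicator_of_mem hmem] at h
  rw [Nat.cast_succ]
  exact h
end
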